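/- (Lemma 2, necessity direction.) Let T > 0, W > 0, P̄ > 0, and let N : ℝ → ℝ be continuous with N(τ) > 0 on [0, T]. Call a measurable P : ℝ → ℝ feasible if P(τ) ≥ 0 on [0, T] and ∫₀^T P(τ)dτ = P̄·T, and write C_P(τ) := W·ln(1 + P(τ)/N(τ)). Suppose P is feasible, bounded, with P(τ) > 0 a.e. on [0, T], ln C_P is integrable on [0, T], and P maximizes the objective: for every feasible Q with Q > 0 a.e. and ln C_Q integrable on [0, T], ∫₀^T ln C_Q(τ)dτ ≤ ∫₀^T ln C_P(τ)dτ. Then for every feasible bounded Q with Q > 0 a.e., ln C_Q integrable and (C_Q − C_P)/C_P integrable on [0, T], one has ∫₀^T (C_Q(τ) − C_P(τ))/C_P(τ) dτ ≤ 0. (A maximizer of ∫₀^T ln C_P(τ)dτ is proportionally fair along time.) -/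

import Mathlib

open MeasureTheory

lemma abs_log_one_add_mul_le {ε g : ℝ} (hε : 0 ≤ ε) (hε' : ε ≤ 1 / 2) (hg : -1 < g) :
    |Real.log (1 + ε * g)| ≤ 2 * ε * |g| := by
  have hhalf : 1 / 2 ≤ 1 + ε * g := by nlinarith
  have hpos : 0 < 1 + ε * g := by linarith
  have hupper := Real.log_le_sub_one_of_pos hpos
  have hlower := Real.one_sub_inv_le_log_of_pos hpos
  have heq : 1 - (1 + ε * g)⁻¹ = (1 + ε * g)⁻¹ * (ε * g) := by field_simp; ring
  have hinv : (1 + ε * g)⁻¹ ≤ 2 := by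
    rw [inv_le_comm₀ hpos two_pos]; linarith
  have habs : |ε * g| = ε * |g| := by rw [abs_mul, abs_of_nonneg hε]
  have hnn : 0 ≤ ε * |g| := by positivity
  have hbound : |(1 + ε * g)⁻¹ * (ε * g)| ≤ 2 * (ε * |g|) := by
    rw [abs_mul, habs, abs_of_pos (inv_pos.2 hpos)]
    gcongr
  rw [abs_le]
  constructor
  · linarith [(abs_le.1 hbound).1]
  · linarith [le_abs_self (ε * g)]

lemma integrable_log_one_add_mul {α : Type*} [MeasurableSpace α] {μ : Measure α} {g : α → ℝ}
    (hg : Integrable g μ) (hg1 : ∀ᵐ x ∂μ, -1 < g x) {ε : ℝ} (hε : 0 ≤ ε) (hε' : ε ≤ 1 / 2) :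
    Integrable (fun x => Real.log (1 + ε * g x)) μ := by
  refine (hg.abs.const_mul (2 * ε)).mono' ?_ ?_
  · exact (Real.measurable_log.comp_aemeasurable
      ((hg.aemeasurable.const_mul ε).const_add 1)).aestronglyMeasurable
  · filter_upwards [hg1] with x hx using abs_log_one_add_mul_le hε hε' hx

lemma integral_nonpos_of_integral_log_one_add_mul_nonpos {α : Type*} [MeasurableSpace α]
    {μ : Measure α} {g : α → ℝ} (hg : Integrable g μ) (hg1 : ∀ᵐ x ∂μ, -1 < g x)
    (h : ∀ ε : ℝ, 0 < ε → ε ≤ 1 / 2 → ∫ x, Real.log (1 + ε * g x) ∂μ ≤ 0) :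
    ∫ x, g x ∂μ ≤ 0 := by
  have hsmall : ∀ᶠ ε : ℝ in nhdsWithin 0 (Set.Ioi 0), 0 < ε ∧ ε ≤ 1 / 2 :=
    Filter.mem_of_superset (Ioc_mem_nhdsGT (by norm_num : (0 : ℝ) < 1 / 2)) fun _ hε => hε
  have hlim : Filter.Tendsto (fun ε : ℝ => ∫ x, ε⁻¹ * Real.log (1 + ε * g x) ∂μ)
      (nhdsWithin 0 (Set.Ioi 0)) (nhds (∫ x, g x ∂μ)) := by
    refine tendsto_integral_filter_of_dominated_convergence (fun x => 2 * |g x|) ?_ ?_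
      (hg.abs.const_mul 2) ?_
    · filter_upwards [hsmall] with ε hε
      exact ((integrable_log_one_add_mul hg hg1 hε.1.le hε.2).const_mul _).aestronglyMeasurable
    · filter_upwards [hsmall] with ε hε
      filter_upwards [hg1] with x hx
      rw [Real.norm_eq_abs, abs_mul, abs_of_pos (inv_pos.2 hε.1), inv_mul_le_iff₀ hε.1]
      linarith [abs_log_one_add_mul_le hε.1.le hε.2 hx]
    · refine Filter.Eventually.of_forall fun x => ?_
      have hderiv : HasDerivAt (fun ε : ℝ => Real.log (1 + ε * g x)) (g x) 0 := by
        have := (((hasDerivAt_id (0 : ℝ)).mul_const (g x)).const_add 1).log (by simp)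
        simpa using this
      simpa using hderiv.tendsto_slope_zero_right
  refine le_of_tendsto hlim ?_
  filter_upwards [hsmall] with ε hε
  rw [integral_const_mul]
  exact mul_nonpos_of_nonneg_of_nonpos (inv_pos.2 hε.1).le (h ε hε.1 hε.2)

lemma log_one_add_convexComb_ge {a b ε : ℝ} (ha : 0 ≤ a) (hb : 0 ≤ b) (hε : 0 ≤ ε)
    (hε' : ε ≤ 1) :
    (1 - ε) * Real.log (1 + a) + ε * Real.log (1 + b) ≤
      Real.log (1 + ((1 - ε) * a + ε * b)) := by
  have h := strictConcaveOn_log_Ioi.concaveOn.2 (Set.mem_Ioi.2 (by linarith : 0 < 1 + a))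
    (Set.mem_Ioi.2 (by linarith : 0 < 1 + b)) (sub_nonneg.2 hε') hε (by ring)
  simp only [smul_eq_mul] at h
  rwa [show (1 - ε) * (1 + a) + ε * (1 + b) = 1 + ((1 - ε) * a + ε * b) by ring] at h

/-- The capacity of bandwidth `W` at power `p` and effective noise power `n`. -/
noncomputable def capacity (W p n : ℝ) : ℝ := W * Real.log (1 + p / n)

section capacity

variable {W n p q ε : ℝ}

lemma capacity_pos (hW : 0 < W) (hn : 0 < n) (hp : 0 < p) : 0 < capacity W p n :=
  mul_pos hW (Real.log_pos (by linarith [div_pos hp hn]))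

lemma capacity_le_capacity (hW : 0 < W) (hn : 0 < n) (hp : 0 < p) (hpq : p ≤ q) :
    capacity W p n ≤ capacity W q n := by
  have := div_pos hp hn
  unfold capacity
  gcongr

lemma le_capacity_convexComb (hW : 0 < W) (hn : 0 < n) (hp : 0 < p) (hq : 0 < q)
    (hε : 0 ≤ ε) (hε' : ε ≤ 1) :
    (1 - ε) * capacity W p n + ε * capacity W q n ≤
      capacity W ((1 - ε) * p + ε * q) n := by
  have h := mul_le_mul_of_nonneg_left
    (log_one_add_convexComb_ge (div_pos hp hn).le (div_pos hq hn).le hε hε') hW.le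
  rw [show (1 - ε) * (p / n) + ε * (q / n) = ((1 - ε) * p + ε * q) / n by ring] at h
  unfold capacity
  linarith

lemma log_capacity_add_log_le (hW : 0 < W) (hn : 0 < n) (hp : 0 < p) (hq : 0 < q)
    (hε : 0 ≤ ε) (hε' : ε < 1) :
    Real.log (capacity W p n) +
        Real.log (1 + ε * ((capacity W q n - capacity W p n) / capacity W p n)) ≤
      Real.log (capacity W ((1 - ε) * p + ε * q) n) := by
  have hcp := capacity_pos hW hn hp
  have hcq := capacity_pos hW hn hq
  have heq : capacity W p n * (1 + ε * ((capacity W q n - capacity W p n) / capacity W p n)) =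
      (1 - ε) * capacity W p n + ε * capacity W q n := by field_simp; ring
  have hpos : 0 < (1 - ε) * capacity W p n + ε * capacity W q n := by
    have := mul_pos (sub_pos.2 hε') hcp
    positivity
  rw [← Real.log_mul hcp.ne' (by intro h0; rw [h0, mul_zero] at heq; linarith), heq]
  exact Real.log_le_log hpos (le_capacity_convexComb hW hn hp hq hε hε'.le)

lemma abs_log_capacity_convexComb_le (hW : 0 < W) (hn : 0 < n) (hp : 0 < p) (hq : 0 < q)
    (hε : 0 ≤ ε) (hε' : ε ≤ 1) :
    |Real.log (capacity W ((1 - ε) * p + ε * q) n)| ≤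
      |Real.log (capacity W p n)| + |Real.log (capacity W q n)| := by
  have key : ∀ a b δ : ℝ, 0 < a → a ≤ b → 0 ≤ δ → δ ≤ 1 →
      |Real.log (capacity W ((1 - δ) * a + δ * b) n)| ≤
        |Real.log (capacity W a n)| + |Real.log (capacity W b n)| := by
    intro a b δ ha hab hδ hδ'
    have h1 : a ≤ (1 - δ) * a + δ * b := by nlinarith
    have h2 : (1 - δ) * a + δ * b ≤ b := by nlinarith
    have h3 := Real.log_le_log (capacity_pos hW hn ha) (capacity_le_capacity hW hn ha h1)
    have h4 := Real.log_le_log (capacity_pos hW hn (ha.trans_le h1))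
      (capacity_le_capacity hW hn (ha.trans_le h1) h2)
    refine (abs_le_max_abs_abs h3 h4).trans (max_le ?_ ?_) <;> simp
  rcases le_total p q with hpq | hqp
  · exact key p q ε hp hpq hε hε'
  · have h := key q p (1 - ε) hq hqp (by linarith) (by linarith)
    rwa [sub_sub_cancel, add_comm (ε * q), add_comm |_|] at h

end capacity

/-- Lemma 2, necessity direction: a maximizer `P` of `∫₀ᵀ ln C_P(τ) dτ` over the
feasible power allocations (with `C_P(τ) = W * ln(1 + P(τ)/N(τ))`) is
proportionally fair along time: `∫₀ᵀ (C_Q - C_P)/C_P ≤ 0` for every feasible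
bounded `Q > 0` a.e. with the stated integrability. -/
theorem log_max_implies_pf_along_time (T W Pbar : ℝ)
    (hT : 0 < T) (hW : 0 < W) (hPbar : 0 < Pbar)
    (N : ℝ → ℝ) (hNcont : Continuous N) (hNpos : ∀ τ ∈ Set.Icc (0 : ℝ) T, 0 < N τ)
    (P : ℝ → ℝ) (hPmeas : Measurable P) (hPnn : ∀ τ ∈ Set.Icc (0 : ℝ) T, 0 ≤ P τ)
    (hPtot : (∫ τ in (0 : ℝ)..T, P τ) = Pbar * T)
    (hPbdd : ∃ M : ℝ, ∀ τ ∈ Set.Icc (0 : ℝ) T, P τ ≤ M)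
    (hPpos : ∀ᵐ τ ∂volume, τ ∈ Set.Icc (0 : ℝ) T → 0 < P τ)
    (hPlogint : IntervalIntegrable
      (fun τ => Real.log (W * Real.log (1 + P τ / N τ))) volume 0 T)
    (hmax : ∀ Q : ℝ → ℝ, Measurable Q → (∀ τ ∈ Set.Icc (0 : ℝ) T, 0 ≤ Q τ) →
      (∫ τ in (0 : ℝ)..T, Q τ) = Pbar * T →
      (∀ᵐ τ ∂volume, τ ∈ Set.Icc (0 : ℝ) T → 0 < Q τ) →
      IntervalIntegrable (fun τ => Real.log (W * Real.log (1 + Q τ / N τ))) volume 0 T →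
      (∫ τ in (0 : ℝ)..T, Real.log (W * Real.log (1 + Q τ / N τ))) ≤
        ∫ τ in (0 : ℝ)..T, Real.log (W * Real.log (1 + P τ / N τ))) :
    ∀ Q : ℝ → ℝ, Measurable Q → (∀ τ ∈ Set.Icc (0 : ℝ) T, 0 ≤ Q τ) →
      (∫ τ in (0 : ℝ)..T, Q τ) = Pbar * T →
      (∃ M : ℝ, ∀ τ ∈ Set.Icc (0 : ℝ) T, Q τ ≤ M) →
      (∀ᵐ τ ∂volume, τ ∈ Set.Icc (0 : ℝ) T → 0 < Q τ) →
      IntervalIntegrable (fun τ => Real.log (W * Real.log (1 + Q τ / N τ))) volume 0 T →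
      IntervalIntegrable (fun τ =>
        (W * Real.log (1 + Q τ / N τ) - W * Real.log (1 + P τ / N τ)) /
          (W * Real.log (1 + P τ / N τ))) volume 0 T →
      (∫ τ in (0 : ℝ)..T,
        (W * Real.log (1 + Q τ / N τ) - W * Real.log (1 + P τ / N τ)) /
          (W * Real.log (1 + P τ / N τ))) ≤ 0 := by
  intro Q hQmeas hQnn hQtot _ hQpos hQlogint hgint
  simp only [← capacity.eq_1] at *
  have hTP : Pbar * T ≠ 0 := (mul_pos hPbar hT).ne'
  have hPint : IntervalIntegrable P volume 0 T := by
    by_contra h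
    exact hTP (hPtot ▸ intervalIntegral.integral_undef h)
  have hQint : IntervalIntegrable Q volume 0 T := by
    by_contra h
    exact hTP (hQtot ▸ intervalIntegral.integral_undef h)
  have hpos : ∀ᵐ τ ∂volume.restrict (Set.Ioc 0 T), 0 < N τ ∧ 0 < P τ ∧ 0 < Q τ := by
    rw [ae_restrict_iff' measurableSet_Ioc]
    filter_upwards [hPpos, hQpos] with τ hP hQ hτ
    have hτ' := Set.Ioc_subset_Icc_self hτ
    exact ⟨hNpos τ hτ', hP hτ', hQ hτ'⟩
  rw [intervalIntegrable_iff_integrableOn_Ioc_of_le hT.le] at hPlogint hQlogint hgint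
  rw [intervalIntegral.integral_of_le hT.le]
  have hg1 : ∀ᵐ τ ∂volume.restrict (Set.Ioc 0 T),
      -1 < (capacity W (Q τ) (N τ) - capacity W (P τ) (N τ)) / capacity W (P τ) (N τ) := by
    filter_upwards [hpos] with τ ⟨hn, hp, hq⟩
    rw [lt_div_iff₀ (capacity_pos hW hn hp)]
    linarith [capacity_pos hW hn hq]
  refine integral_nonpos_of_integral_log_one_add_mul_nonpos hgint hg1 fun ε hε hε' => ?_
  have hε1 : ε ≤ 1 := by linarith
  have hRmeas : Measurable fun τ => (1 - ε) * P τ + ε * Q τ := by fun_prop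
  have hRlogint : IntegrableOn
      (fun τ => Real.log (capacity W ((1 - ε) * P τ + ε * Q τ) (N τ))) (Set.Ioc 0 T) := by
    refine (hPlogint.abs.add hQlogint.abs).mono' ?_ ?_
    · have := hNcont.measurable
      unfold capacity
      exact Measurable.aestronglyMeasurable (by fun_prop)
    · filter_upwards [hpos] with τ ⟨hn, hp, hq⟩
      exact abs_log_capacity_convexComb_le hW hn hp hq hε.le hε1
  have hmaxR := hmax (fun τ => (1 - ε) * P τ + ε * Q τ) hRmeas
    (fun τ hτ => add_nonneg (mul_nonneg (by linarith) (hPnn τ hτ)) (mul_nonneg hε.le (hQnn τ hτ)))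
    (by
      rw [intervalIntegral.integral_add (hPint.const_mul _) (hQint.const_mul _),
        intervalIntegral.integral_const_mul, intervalIntegral.integral_const_mul, hPtot, hQtot]
      ring)
    (by
      filter_upwards [hPpos, hQpos] with τ hP hQ hτ
      exact add_pos (mul_pos (by linarith) (hP hτ)) (mul_pos hε (hQ hτ)))
    ((intervalIntegrable_iff_integrableOn_Ioc_of_le hT.le).2 hRlogint)
  rw [intervalIntegral.integral_of_le hT.le, intervalIntegral.integral_of_le hT.le] at hmaxR
  have hlogint := integrable_log_one_add_mul hgint hg1 hε.le hε'
  have hle := integral_mono_ae (hPlogint.add hlogint) hRlogint (by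
    filter_upwards [hpos] with τ ⟨hn, hp, hq⟩
    exact log_capacity_add_log_le hW hn hp hq hε.le (by linarith))
  rw [integral_add' hPlogint hlogint] at hle
  linarith
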